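/- arXiv:1703.01847 — 3 statements merged into one kernel-verified Lean document; each statement's English description precedes it below -/
import Mathlib

section
/- Let n, s, k be positive integers with s ≤ n and 2k ≤ e^{s/2}. Let S_1, …, S_k be independent random subsets of [n], each distributed uniformly over all (n−s)-subsets of [n], and let U ⊆ [n] be a fixed subset. Then the probability that |U \ (S_1 ∪ … ∪ S_k)| < (|U|/2)·(s/(2n))^k is less than 2·exp(−(|U|/8)·(s/(2n))^k). -/
open MeasureTheory

instance (α : Type*) : MeasurableSpace (Finset α) := ⊤

/-- The uniform probability measure on the `r`-subsets of `[n] = Fin n` (for `r ≤ n`). -/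
noncomputable def uniformSubsetMeasure (n r : ℕ) (h : r ≤ n) :
    Measure (Finset (Fin n)) :=
  (PMF.uniformOfFinset (Finset.univ.filter fun S : Finset (Fin n) => S.card = r)
    (by
      obtain ⟨T, -, hT⟩ := Finset.exists_subset_card_eq
        (show r ≤ (Finset.univ : Finset (Fin n)).card by simpa using h)
      exact ⟨T, by simp [hT]⟩)).toMeasure

lemma cov_choose (n r : ℕ) : ∀ b : ℕ, b ≤ r → r ≤ n →
    (n - b).choose (r - b) * n ^ b ≤ r ^ b * n.choose r := by
  intro b
  induction b with
  | zero => intro _ _; simp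
  | succ b ih =>
    intro hb hr
    have h1 := ih (by omega) hr
    obtain ⟨c, rfl⟩ : ∃ c, r = b + 1 + c := ⟨r - (b + 1), by omega⟩
    obtain ⟨d, rfl⟩ : ∃ d, n = b + 1 + c + d := ⟨n - (b + 1 + c), by omega⟩
    have e1 : b + 1 + c + d - (b + 1) = c + d := by omega
    have e2 : b + 1 + c - (b + 1) = c := by omega
    have e3 : b + 1 + c + d - b = c + d + 1 := by omega
    have e4 : b + 1 + c - b = c + 1 := by omega
    rw [e1, e2]
    rw [e3, e4] at h1
    have h2 := Nat.add_one_mul_choose_eq (c + d) c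
    set X := (c + d).choose c
    set Y := (c + d + 1).choose (c + 1)
    have h3 : X * (b + 1 + c + d) ≤ (b + 1 + c) * Y := by
      have h4 : (c + d + 1) * (X * (b + 1 + c + d)) ≤ (c + d + 1) * ((b + 1 + c) * Y) := by
        calc (c + d + 1) * (X * (b + 1 + c + d)) = Y * ((c + 1) * (b + 1 + c + d)) := by
              rw [← mul_assoc, h2]; ring
          _ ≤ Y * ((c + d + 1) * (b + 1 + c)) := by
              apply Nat.mul_le_mul_left; nlinarith [Nat.zero_le (b * d)]
          _ = _ := by ring
      exact Nat.le_of_mul_le_mul_left h4 (by omega)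
    calc X * (b + 1 + c + d) ^ (b + 1) = X * (b + 1 + c + d) * (b + 1 + c + d) ^ b := by ring
      _ ≤ (b + 1 + c) * Y * (b + 1 + c + d) ^ b := Nat.mul_le_mul_right _ h3
      _ = (b + 1 + c) * (Y * (b + 1 + c + d) ^ b) := by ring
      _ ≤ (b + 1 + c) * ((b + 1 + c) ^ b * (b + 1 + c + d).choose (b + 1 + c)) :=
          Nat.mul_le_mul_left _ h1
      _ = _ := by ring

lemma cov_count (n r : ℕ) (hr : r ≤ n) (B : Finset (Fin n)) :
    (Finset.univ.filter fun S : Finset (Fin n) => S.card = r ∧ B ⊆ S).card * n ^ B.card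
      ≤ r ^ B.card * n.choose r := by
  by_cases hb : B.card ≤ r
  · refine le_trans (Nat.mul_le_mul_right _ ?_) (cov_choose n r B.card hb hr)
    have : ((Finset.univ \ B).powersetCard (r - B.card)).card
        = (n - B.card).choose (r - B.card) := by
      rw [Finset.card_powersetCard, Finset.card_sdiff_of_subset (Finset.subset_univ _)]
      simp
    rw [← this]
    apply Finset.card_le_card_of_injOn (fun S => S \ B)
    · intro S hS
      simp only [Finset.coe_filter, Finset.mem_univ, true_and, Set.mem_ofPred_eq] at hS
      simp only [Finset.mem_coe, Finset.mem_powersetCard]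
      exact ⟨Finset.sdiff_subset_sdiff (Finset.subset_univ _) le_rfl, by
        rw [Finset.card_sdiff_of_subset hS.2, hS.1]⟩
    · intro S hS T hT h
      simp only [Finset.coe_filter, Finset.mem_univ, true_and, Set.mem_ofPred_eq] at hS hT
      rw [← Finset.sdiff_union_of_subset hS.2, ← Finset.sdiff_union_of_subset hT.2]
      simp only at h
      rw [h]
  · have : (Finset.univ.filter fun S : Finset (Fin n) => S.card = r ∧ B ⊆ S) = ∅ := by
      apply Finset.filter_eq_empty_iff.2
      rintro S - ⟨h1, h2⟩
      exact hb (h1 ▸ Finset.card_le_card h2)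
    rw [this]; simp

/-- point masses -/
noncomputable def covW (n r : ℕ) (S : Finset (Fin n)) : ℝ :=
  if S.card = r then ((n.choose r : ℕ) : ℝ)⁻¹ else 0

lemma covW_nonneg (n r : ℕ) (S : Finset (Fin n)) : 0 ≤ covW n r S := by
  unfold covW; split_ifs <;> positivity

lemma cov_expand {n : ℕ} (A S : Finset (Fin n)) (z : ℝ) :
    z ^ (A \ S).card = ∑ B ∈ A.powerset,
      (1 - z) ^ B.card * z ^ (A.card - B.card) * (if B ⊆ S then 1 else 0) := by
  have h1 : z ^ (A \ S).card = ∏ a ∈ A, ((if a ∈ S then (1 - z) else 0) + z) := by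
    rw [← Finset.prod_sdiff (Finset.inter_subset_left (s₁ := A) (s₂ := S))]
    rw [Finset.sdiff_inter_self_left]
    rw [Finset.prod_congr rfl (g := fun _ => z), Finset.prod_const,
      Finset.prod_eq_one (s := A ∩ S), mul_one]
    · intro x hx
      simp [(Finset.mem_inter.1 hx).2]
    · intro x hx
      simp [(Finset.mem_sdiff.1 hx).2]
  rw [h1, Finset.prod_add]
  apply Finset.sum_congr rfl
  intro B hB
  rw [Finset.prod_const, Finset.card_sdiff_of_subset (Finset.mem_powerset.1 hB)]
  by_cases h : B ⊆ S
  · rw [Finset.prod_congr rfl (g := fun _ => 1 - z), Finset.prod_const]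
    · simp [h]
    · intro x hx; simp [h hx]
  · obtain ⟨x, hx, hxS⟩ := Finset.not_subset.1 h
    rw [Finset.prod_eq_zero hx (by simp [hxS])]
    simp [h]

lemma cov_step (n r : ℕ) (hn : 0 < n) (hr : r ≤ n) (A : Finset (Fin n)) (z : ℝ) (h0 : 0 ≤ z)
    (h1 : z ≤ 1) :
    ∑ S, covW n r S * z ^ (A \ S).card ≤ ((1 - z) * (r / n) + z) ^ A.card := by
  have hn' : (0 : ℝ) < n := by exact_mod_cast hn
  have hB : ∀ B : Finset (Fin n),
      ∑ S, covW n r S * (if B ⊆ S then 1 else 0) ≤ ((r : ℝ) / n) ^ B.card := by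
    intro B
    have h := cov_count n r hr B
    have hc : 0 < n.choose r := Nat.choose_pos hr
    have hc' : (0 : ℝ) < (n.choose r : ℕ) := by exact_mod_cast hc
    have e : ∑ S, covW n r S * (if B ⊆ S then 1 else 0) =
        ((Finset.univ.filter fun S : Finset (Fin n) => S.card = r ∧ B ⊆ S).card : ℝ)
          * ((n.choose r : ℕ) : ℝ)⁻¹ := by
      rw [← nsmul_eq_mul, ← Finset.sum_const, Finset.sum_filter]
      apply Finset.sum_congr rfl
      intro S _
      unfold covW
      by_cases h1 : S.card = r <;> by_cases h2 : B ⊆ S <;> simp [h1, h2]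
    rw [e, div_pow, ← div_eq_mul_inv, div_le_div_iff₀ hc' (by positivity)]
    exact_mod_cast h
  calc ∑ S, covW n r S * z ^ (A \ S).card
      = ∑ B ∈ A.powerset, (1 - z) ^ B.card * z ^ (A.card - B.card) *
          ∑ S, covW n r S * (if B ⊆ S then 1 else 0) := by
        simp_rw [cov_expand A _ z, Finset.mul_sum]
        rw [Finset.sum_comm]
        refine Finset.sum_congr rfl fun B _ => Finset.sum_congr rfl fun S _ => by ring
    _ ≤ ∑ B ∈ A.powerset, (1 - z) ^ B.card * z ^ (A.card - B.card) * ((r : ℝ) / n) ^ B.card := by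
        refine Finset.sum_le_sum fun B _ => mul_le_mul_of_nonneg_left (hB B) ?_
        have : 0 ≤ 1 - z := by linarith
        positivity
    _ = _ := by
        rw [← Finset.sum_pow_mul_eq_add_pow]
        refine Finset.sum_congr rfl fun B _ => ?_
        rw [mul_pow]; ring

lemma cov_iter (n s : ℕ) (hn : 0 < n) (hsn : s ≤ n) (z : ℝ) (h0 : 0 ≤ z) (h1 : z ≤ 1) :
    ∀ (k : ℕ) (U : Finset (Fin n)),
    ∑ S : Fin k → Finset (Fin n), (∏ i, covW n (n - s) (S i)) *
        z ^ (U \ Finset.univ.sup S).card ≤ (1 - ((s : ℝ) / n) ^ k * (1 - z)) ^ U.card := by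
  have hn' : (0 : ℝ) < n := by exact_mod_cast hn
  have hs' : (s : ℝ) ≤ n := by exact_mod_cast hsn
  have hp0 : 0 ≤ (s : ℝ) / n := by positivity
  have hp1 : (s : ℝ) / n ≤ 1 := (div_le_one hn').2 hs'
  intro k
  induction k with
  | zero => intro U; simp
  | succ k ih =>
    intro U
    have hq0 : 0 ≤ ((s : ℝ) / n) ^ k := by positivity
    have hq1 : ((s : ℝ) / n) ^ k ≤ 1 := pow_le_one₀ hp0 hp1
    rw [← (Fin.consEquiv fun _ : Fin (k + 1) => Finset (Fin n)).sum_comp, Fintype.sum_prod_type]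
    calc _ = ∑ S0, covW n (n - s) S0 * ∑ S : Fin k → Finset (Fin n),
          (∏ i, covW n (n - s) (S i)) * z ^ ((U \ S0) \ Finset.univ.sup S).card := by
          refine Finset.sum_congr rfl fun S0 _ => ?_
          rw [Finset.mul_sum]
          refine Finset.sum_congr rfl fun S _ => ?_
          have e : Finset.univ.sup (Fin.cons S0 S : Fin (k + 1) → Finset (Fin n))
              = S0 ∪ Finset.univ.sup S := by
            ext x
            simp [Finset.mem_sup, Fin.exists_fin_succ]
          simp only [Fin.consEquiv, Equiv.coe_fn_mk, Fin.prod_univ_succ, Fin.cons_zero,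
            Fin.cons_succ]
          rw [e, sdiff_sdiff_left, Finset.sup_eq_union]
          ring
      _ ≤ ∑ S0, covW n (n - s) S0 * (1 - ((s : ℝ) / n) ^ k * (1 - z)) ^ (U \ S0).card :=
          Finset.sum_le_sum fun S0 _ => mul_le_mul_of_nonneg_left (ih _) (covW_nonneg _ _ _)
      _ ≤ _ := cov_step n (n - s) hn (Nat.sub_le _ _) U _ (by nlinarith) (by nlinarith)
      _ = _ := by
          rw [Nat.cast_sub hsn]
          congr 1
          rw [pow_succ, sub_div, div_self hn'.ne']
          ring

lemma cov_mass (n r : ℕ) (h : r ≤ n) (S : Finset (Fin n)) :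
    (uniformSubsetMeasure n r h {S}).toReal = covW n r S := by
  unfold uniformSubsetMeasure covW
  rw [PMF.toMeasure_apply_singleton _ _ (MeasurableSet.of_discrete), PMF.uniformOfFinset_apply]
  have : (Finset.univ.filter fun S : Finset (Fin n) => S.card = r).card = n.choose r := by
    have := Finset.card_powersetCard r (Finset.univ : Finset (Fin n))
    rw [Finset.card_univ, Fintype.card_fin] at this
    rw [← this]
    congr 1
    ext; simp [Finset.mem_powersetCard]
  simp only [Finset.mem_filter, Finset.mem_univ, true_and, this]
  split_ifs <;> simp

instance cov_prob (n r : ℕ) (h : r ≤ n) : IsProbabilityMeasure (uniformSubsetMeasure n r h) := by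
  unfold uniformSubsetMeasure; infer_instance

/-- **Coverage lemma** (Lemma 2.2): if `S_1, …, S_k` are independent uniformly random
`(n-s)`-subsets of `[n]` with `2k ≤ e^{s/2}`, and `U ⊆ [n]` is fixed, then the probability
that `|U \ (S_1 ∪ ⋯ ∪ S_k)| < (|U|/2)·(s/(2n))^k` is less than
`2·exp(−(|U|/8)·(s/(2n))^k)`. -/
theorem coverage_lemma (n s k : ℕ) (hn : 0 < n) (hs : 0 < s) (hk : 0 < k) (hsn : s ≤ n)
    (hke : (2 * k : ℝ) ≤ Real.exp ((s : ℝ) / 2)) (U : Finset (Fin n)) :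
    ((Measure.pi fun _ : Fin k => uniformSubsetMeasure n (n - s) (Nat.sub_le n s))
        {S : Fin k → Finset (Fin n) |
          ((U \ Finset.univ.sup S).card : ℝ) <
            ((U.card : ℝ) / 2) * ((s : ℝ) / (2 * n)) ^ k}).toReal <
      2 * Real.exp (-((U.card : ℝ) / 8) * ((s : ℝ) / (2 * n)) ^ k) := by
  classical
  set q : ℝ := ((s : ℝ) / (2 * n)) ^ k with hq
  have hn' : (0 : ℝ) < n := by exact_mod_cast hn
  have hq0 : 0 ≤ q := by positivity
  set t : ℝ := (U.card : ℝ) / 2 * q with ht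
  set μ := Measure.pi fun _ : Fin k => uniformSubsetMeasure n (n - s) (Nat.sub_le n s) with hμ
  set E : Set (Fin k → Finset (Fin n)) := {S | ((U \ Finset.univ.sup S).card : ℝ) < t} with hE
  have hsum : (μ E).toReal = ∑ S ∈ E.toFinset, ∏ i, covW n (n - s) (S i) := by
    have h := MeasureTheory.sum_measureReal_singleton (μ := μ) E.toFinset
    rw [Set.coe_toFinset] at h
    rw [← Measure.real, ← h]
    refine Finset.sum_congr rfl fun S _ => ?_
    rw [Measure.real, hμ, Measure.pi_singleton, ENNReal.toReal_prod]
    exact Finset.prod_congr rfl fun i _ => cov_mass _ _ _ _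
  have hw : ∀ S : Fin k → Finset (Fin n), 0 ≤ ∏ i, covW n (n - s) (S i) :=
    fun S => Finset.prod_nonneg fun i _ => covW_nonneg _ _ _
  have hpq : ((s : ℝ) / n) ^ k = 2 ^ k * q := by
    rw [hq, ← mul_pow]; congr 1; field_simp
  have h2k : (2 : ℝ) ≤ 2 ^ k := by
    calc (2 : ℝ) = 2 ^ 1 := by norm_num
      _ ≤ 2 ^ k := pow_le_pow_right₀ (by norm_num) hk
  have hb : (1 - ((s : ℝ) / n) ^ k * (1 - 1 / 2)) ^ U.card ≤ Real.exp (-q * U.card) := by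
    have hp1 : ((s : ℝ) / n) ^ k ≤ 1 :=
      pow_le_one₀ (by positivity) ((div_le_one hn').2 (by exact_mod_cast hsn))
    rw [mul_comm (-q), Real.exp_nat_mul]
    apply pow_le_pow_left₀ (by linarith)
    have := Real.add_one_le_exp (-q)
    nlinarith
  have hmain : (μ E).toReal ≤ Real.exp (t * Real.log 2) * Real.exp (-q * U.card) := by
    rw [hsum]
    calc ∑ S ∈ E.toFinset, ∏ i, covW n (n - s) (S i)
        ≤ ∑ S ∈ E.toFinset, Real.exp (t * Real.log 2) * ((∏ i, covW n (n - s) (S i)) *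
            (1 / 2 : ℝ) ^ (U \ Finset.univ.sup S).card) := by
          refine Finset.sum_le_sum fun S hS => ?_
          have hS' : ((U \ Finset.univ.sup S).card : ℝ) < t := by
            simpa [hE] using hS
          set m := (U \ Finset.univ.sup S).card
          have h1 : (1 : ℝ) ≤ Real.exp (t * Real.log 2) * (1 / 2 : ℝ) ^ m := by
            have : (1 / 2 : ℝ) ^ m = Real.exp (-(m * Real.log 2)) := by
              rw [Real.exp_neg, Real.exp_nat_mul, Real.exp_log (by norm_num)]; simp
            rw [this, ← Real.exp_add]
            apply Real.one_le_exp
            have := Real.log_pos (x := 2) (by norm_num)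
            nlinarith
          nlinarith [hw S]
      _ ≤ ∑ S, Real.exp (t * Real.log 2) * ((∏ i, covW n (n - s) (S i)) *
            (1 / 2 : ℝ) ^ (U \ Finset.univ.sup S).card) := by
          refine Finset.sum_le_sum_of_subset_of_nonneg (Finset.subset_univ _) fun S _ _ => ?_
          have := hw S
          positivity
      _ ≤ _ := by
          rw [← Finset.mul_sum]
          refine mul_le_mul_of_nonneg_left ?_ (Real.exp_pos _).le
          exact (cov_iter n s hn hsn (1 / 2) (by norm_num) (by norm_num) k U).trans hb
  have hfin : Real.exp (t * Real.log 2) * Real.exp (-q * U.card)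
      ≤ Real.exp (-((U.card : ℝ) / 8) * q) := by
    rw [← Real.exp_add, Real.exp_le_exp]
    have hl : Real.log 2 ≤ 1 := by linarith [Real.log_two_lt_d9]
    have ht0 : 0 ≤ t := by positivity
    have : t * Real.log 2 ≤ t := by nlinarith
    have hUq : 0 ≤ (U.card : ℝ) * q := by positivity
    rw [ht] at this ⊢
    nlinarith
  have := Real.exp_pos (-((U.card : ℝ) / 8) * q)
  linarith
end

section
/- Let n be a positive integer divisible by 4, and let k be a positive integer with 2k ≤ e^{n/8}. Let Z_1, …, Z_k be independent random subsets of [n], each distributed uniformly over all (3n/4)-subsets of [n]. Then the probability that |[n] \ (Z_1 ∪ … ∪ Z_k)| < (n/2)·8^{−k} is less than 2·exp(−(n/8)·8^{−k}). -/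
open MeasureTheory

lemma card_superset (n r : ℕ) (T : Finset (Fin n)) (hT : T.card ≤ r) :
    (Finset.univ.filter fun S : Finset (Fin n) => S.card = r ∧ T ⊆ S).card
      = (n - T.card).choose (r - T.card) := by
  have h : (Finset.powersetCard (r - T.card) (Tᶜ)).card = (n - T.card).choose (r - T.card) := by
    rw [Finset.card_powersetCard, Finset.card_compl, Fintype.card_fin]
  rw [← h]
  refine Finset.card_bij' (fun S _ => S \ T) (fun S _ => S ∪ T) ?_ ?_ ?_ ?_
  · intro S hS
    simp only [Finset.mem_filter, Finset.mem_univ, true_and] at hS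
    rw [Finset.mem_powersetCard, Finset.card_sdiff_of_subset hS.2, hS.1]
    refine ⟨?_, rfl⟩
    intro x hx
    simp at hx ⊢
    exact hx.2
  · intro S hS
    rw [Finset.mem_powersetCard] at hS
    simp only [Finset.mem_filter, Finset.mem_univ, true_and]
    refine ⟨?_, Finset.subset_union_right⟩
    rw [Finset.card_union_of_disjoint, hS.2]
    · omega
    · exact Finset.subset_compl_iff_disjoint_right.1 hS.1
  · intro S hS
    simp only [Finset.mem_filter, Finset.mem_univ, true_and] at hS
    exact Finset.sdiff_union_of_subset hS.2
  · intro S hS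
    rw [Finset.mem_powersetCard] at hS
    exact Finset.union_sdiff_cancel_right (Finset.subset_compl_iff_disjoint_right.1 hS.1)

lemma choose_ratio (m t : ℕ) (ht : t ≤ 3 * m) :
    (((4 * m - t).choose (3 * m - t) : ℕ) : ℝ)
      ≤ (3 / 4 : ℝ) ^ t * ((4 * m).choose (3 * m) : ℕ) := by
  induction t with
  | zero => simp
  | succ t ih =>
    have ih := ih (by omega)
    obtain ⟨b, hb⟩ : ∃ b, 3 * m = b + (t + 1) := ⟨3 * m - (t + 1), by omega⟩
    obtain ⟨a, ha⟩ : ∃ a, 4 * m = a + (t + 1) := ⟨4 * m - (t + 1), by omega⟩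
    have e1 : 4 * m - (t + 1) = a := by omega
    have e2 : 3 * m - (t + 1) = b := by omega
    have e3 : 4 * m - t = a + 1 := by omega
    have e4 : 3 * m - t = b + 1 := by omega
    rw [e3, e4] at ih
    rw [e1, e2, pow_succ]
    have h := Nat.add_one_mul_choose_eq a b
    have hR : ((a : ℝ) + 1) * (a.choose b : ℕ) = ((a + 1).choose (b + 1) : ℕ) * ((b : ℝ) + 1) := by
      exact_mod_cast h
    have hab : ((b : ℝ) + 1) ≤ 3 / 4 * ((a : ℝ) + 1) := by
      have : 4 * (b + 1) ≤ 3 * (a + 1) := by omega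
      have : (4 : ℝ) * (b + 1) ≤ 3 * (a + 1) := by exact_mod_cast this
      linarith
    have hpos : (0 : ℝ) < (a : ℝ) + 1 := by positivity
    have key : ((a : ℝ) + 1) * (a.choose b : ℕ)
        ≤ ((a : ℝ) + 1) * (3 / 4 * ((a + 1).choose (b + 1) : ℕ)) := by
      rw [hR]
      have := mul_le_mul_of_nonneg_left hab (Nat.cast_nonneg (α := ℝ) ((a + 1).choose (b + 1)))
      linarith
    have := le_of_mul_le_mul_left key hpos
    linarith

lemma prob_superset (m : ℕ) (T : Finset (Fin (4 * m))) :
    ((Finset.univ.filter fun S : Finset (Fin (4 * m)) => S.card = 3 * m ∧ T ⊆ S).card : ℝ)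
      ≤ (3 / 4 : ℝ) ^ T.card * ((4 * m).choose (3 * m) : ℕ) := by
  by_cases hT : T.card ≤ 3 * m
  · rw [card_superset _ _ _ hT]
    exact choose_ratio m _ hT
  · rw [Finset.filter_false_of_mem]
    · simp; positivity
    · rintro S - ⟨h1, h2⟩
      have := Finset.card_le_card h2
      omega

/-- Weight of a subset. -/
noncomputable def wt (m : ℕ) (S : Finset (Fin (4 * m))) : ℝ :=
  if S.card = 3 * m then (((4 * m).choose (3 * m) : ℕ) : ℝ)⁻¹ else 0

lemma wt_nonneg (m : ℕ) (S) : 0 ≤ wt m S := by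
  unfold wt; split_ifs <;> positivity

lemma sum_wt_superset (m : ℕ) (T : Finset (Fin (4 * m))) :
    ∑ S, wt m S * (if T ⊆ S then 1 else 0) ≤ (3 / 4 : ℝ) ^ T.card := by
  have h := prob_superset m T
  have hc : (0 : ℝ) < ((4 * m).choose (3 * m) : ℕ) := by
    exact_mod_cast Nat.choose_pos (by omega)
  have : ∑ S, wt m S * (if T ⊆ S then 1 else 0) =
      ((Finset.univ.filter fun S : Finset (Fin (4 * m)) => S.card = 3 * m ∧ T ⊆ S).card : ℝ) *
        (((4 * m).choose (3 * m) : ℕ) : ℝ)⁻¹ := by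
    rw [← nsmul_eq_mul, ← Finset.sum_const, Finset.sum_filter]
    refine Finset.sum_congr rfl fun S _ => ?_
    unfold wt
    by_cases h1 : S.card = 3 * m <;> by_cases h2 : T ⊆ S <;> simp [h1, h2]
  rw [this, ← div_eq_mul_inv, div_le_iff₀ hc]
  exact h

lemma pow_expand (m : ℕ) (z : ℝ) (U S : Finset (Fin (4 * m))) :
    z ^ (U \ S).card = ∑ T ∈ U.powerset,
      (1 - z) ^ T.card * z ^ (U.card - T.card) * (if T ⊆ S then 1 else 0) := by
  have h1 : z ^ (U \ S).card = ∏ u ∈ U, ((if u ∈ S then 1 - z else 0) + z) := by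
    rw [← Finset.prod_const, ← Finset.filter_notMem_eq_sdiff, Finset.prod_filter]
    refine Finset.prod_congr rfl fun u _ => ?_
    by_cases h : u ∈ S <;> simp [h]
  rw [h1, Finset.prod_add]
  refine Finset.sum_congr rfl fun T hT => ?_
  rw [Finset.mem_powerset] at hT
  rw [Finset.prod_const, Finset.card_sdiff_of_subset hT]
  by_cases h : T ⊆ S
  · rw [Finset.prod_congr rfl (fun u hu => if_pos (h hu))]
    simp [h]
  · obtain ⟨u, hu, hus⟩ := Finset.not_subset.1 h
    rw [Finset.prod_eq_zero hu (by simp [hus])]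
    simp [h]

lemma step (m : ℕ) (z : ℝ) (h0 : 0 ≤ z) (h1 : z ≤ 1) (U : Finset (Fin (4 * m))) :
    ∑ S, wt m S * z ^ (U \ S).card ≤ ((3 + z) / 4) ^ U.card := by
  have h1' : 0 ≤ 1 - z := by linarith
  calc ∑ S, wt m S * z ^ (U \ S).card
      = ∑ T ∈ U.powerset, (1 - z) ^ T.card * z ^ (U.card - T.card) *
          ∑ S, wt m S * (if T ⊆ S then 1 else 0) := by
        simp_rw [pow_expand, Finset.mul_sum]
        rw [Finset.sum_comm]
        refine Finset.sum_congr rfl fun T _ => Finset.sum_congr rfl fun S _ => ?_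
        ring
    _ ≤ ∑ T ∈ U.powerset, (1 - z) ^ T.card * z ^ (U.card - T.card) * (3 / 4 : ℝ) ^ T.card := by
        refine Finset.sum_le_sum fun T _ => ?_
        exact mul_le_mul_of_nonneg_left (sum_wt_superset m T) (by positivity)
    _ = ((1 - z) * (3 / 4) + z) ^ U.card := by
        rw [← Finset.sum_pow_mul_eq_add_pow]
        refine Finset.sum_congr rfl fun T _ => ?_
        rw [mul_pow]; ring
    _ = _ := by congr 1; ring

lemma iter (m : ℕ) (z : ℝ) (h0 : 0 ≤ z) (h1 : z ≤ 1) (k : ℕ) (U : Finset (Fin (4 * m))) :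
    ∑ Z : Fin k → Finset (Fin (4 * m)), (∏ i, wt m (Z i)) * z ^ (U \ Finset.univ.sup Z).card
      ≤ (1 - (1 - z) * (1 / 4) ^ k) ^ U.card := by
  induction k generalizing U with
  | zero => simp
  | succ k ih =>
    have hp : ((1 : ℝ) / 4) ^ k ≤ 1 := pow_le_one₀ (by norm_num) (by norm_num)
    have hp0 : (0 : ℝ) ≤ ((1 : ℝ) / 4) ^ k := by positivity
    rw [← (Fin.consEquiv (fun _ => Finset (Fin (4 * m)))).sum_comp, Fintype.sum_prod_type]
    calc _ = ∑ S, wt m S * ∑ Z : Fin k → Finset (Fin (4 * m)),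
            (∏ i, wt m (Z i)) * z ^ ((U \ S) \ Finset.univ.sup Z).card := by
          refine Finset.sum_congr rfl fun S _ => ?_
          rw [Finset.mul_sum]
          refine Finset.sum_congr rfl fun Z _ => ?_
          have : (Finset.univ.sup (Fin.cons S Z : Fin (k + 1) → Finset (Fin (4 * m))))
              = S ∪ Finset.univ.sup Z := by
            ext x
            simp [Finset.mem_sup, Fin.exists_fin_succ]
          simp only [Fin.consEquiv_apply, Fin.prod_univ_succ, Fin.cons_zero, Fin.cons_succ]
          change _ * z ^ (U \ Finset.univ.sup
            (Fin.cons S Z : Fin (k + 1) → Finset (Fin (4 * m)))).card = _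
          rw [this, sdiff_sdiff_left]
          simp [mul_assoc]
      _ ≤ ∑ S, wt m S * (1 - (1 - z) * (1 / 4) ^ k) ^ (U \ S).card :=
          Finset.sum_le_sum fun S _ => mul_le_mul_of_nonneg_left (ih _) (wt_nonneg m S)
      _ ≤ ((3 + (1 - (1 - z) * (1 / 4) ^ k)) / 4) ^ U.card := by
          apply step
          · nlinarith
          · nlinarith
      _ = _ := by congr 1; ring

instance finsetMSC (α : Type*) : MeasurableSingletonClass (Finset α) := ⟨fun _ => MeasurableSpace.measurableSet_top⟩

instance usm_prob (n r : ℕ) (h : r ≤ n) : IsProbabilityMeasure (uniformSubsetMeasure n r h) := by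
  unfold uniformSubsetMeasure; infer_instance

lemma usm_singleton (m : ℕ) (h : 3 * m ≤ 4 * m) (S : Finset (Fin (4 * m))) :
    (uniformSubsetMeasure (4 * m) (3 * m) h).real {S} = wt m S := by
  unfold uniformSubsetMeasure wt Measure.real
  rw [PMF.toMeasure_apply_singleton _ _ (measurableSet_singleton _), PMF.uniformOfFinset_apply]
  have : (Finset.univ.filter fun S : Finset (Fin (4 * m)) => S.card = 3 * m).card
      = (4 * m).choose (3 * m) := by
    simpa using card_superset (4 * m) (3 * m) ∅ (by simp)
  simp only [Finset.mem_filter, Finset.mem_univ, true_and, this]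
  split_ifs <;> simp

lemma main_aux (m k : ℕ) (hk : 0 < k) (h : 3 * m ≤ 4 * m) :
    ((Measure.pi fun _ : Fin k => uniformSubsetMeasure (4 * m) (3 * m) h)
        {Z : Fin k → Finset (Fin (4 * m)) |
          (((Finset.univ : Finset (Fin (4 * m))) \ Finset.univ.sup Z).card : ℝ) <
            (((4 * m : ℕ) : ℝ) / 2) * ((1 : ℝ) / 8) ^ k}).toReal <
      2 * Real.exp (-(((4 * m : ℕ) : ℝ) / 8) * ((1 : ℝ) / 8) ^ k) := by
  classical
  set n : ℝ := ((4 * m : ℕ) : ℝ) with hn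
  set a : ℝ := n / 2 * (1 / 8) ^ k with ha
  set s := {Z : Fin k → Finset (Fin (4 * m)) |
          (((Finset.univ : Finset (Fin (4 * m))) \ Finset.univ.sup Z).card : ℝ) < a} with hs
  have hn0 : 0 ≤ n := Nat.cast_nonneg _
  have ha0 : 0 ≤ a := by positivity
  have e : ((Measure.pi fun _ : Fin k => uniformSubsetMeasure (4 * m) (3 * m) h) s).toReal
      = ∑ Z ∈ s.toFinset, ∏ i, wt m (Z i) := by
    change (Measure.pi fun _ : Fin k => uniformSubsetMeasure (4 * m) (3 * m) h).real s = _
    conv_lhs => rw [← Set.coe_toFinset s]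
    rw [← sum_measureReal_singleton]
    refine Finset.sum_congr rfl fun Z _ => ?_
    rw [Measure.real, Measure.pi_singleton, ENNReal.toReal_prod]
    exact Finset.prod_congr rfl fun i _ => usm_singleton m h (Z i)
  have hit := iter m (1 / 2) (by norm_num) (by norm_num) k Finset.univ
  have b1 : ∑ Z ∈ s.toFinset, ∏ i, wt m (Z i) ≤ Real.exp a *
      ∑ Z : Fin k → Finset (Fin (4 * m)), (∏ i, wt m (Z i)) *
        (1 / 2 : ℝ) ^ (Finset.univ \ Finset.univ.sup Z).card := by
    rw [Finset.mul_sum]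
    have hw : ∀ Z : Fin k → Finset (Fin (4 * m)), 0 ≤ ∏ i, wt m (Z i) :=
      fun Z => Finset.prod_nonneg fun i _ => wt_nonneg m _
    refine le_trans (Finset.sum_le_sum fun Z hZ => ?_)
      (Finset.sum_le_sum_of_subset_of_nonneg (Finset.subset_univ s.toFinset)
        fun Z _ _ => mul_nonneg (Real.exp_pos _).le (mul_nonneg (hw Z) (by positivity)))
    rw [Set.mem_toFinset] at hZ
    have hZ' : (((Finset.univ : Finset (Fin (4 * m))) \ Finset.univ.sup Z).card : ℝ) < a := hZ
    set c := ((Finset.univ : Finset (Fin (4 * m))) \ Finset.univ.sup Z).card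
    have h2 : Real.exp (-(c : ℝ)) ≤ (1 / 2 : ℝ) ^ c := by
      have : Real.exp (-(c : ℝ)) = (Real.exp (-1)) ^ c := by
        rw [← Real.exp_nat_mul]; congr 1; ring
      rw [this]
      refine pow_le_pow_left₀ (Real.exp_pos _).le ?_ _
      rw [Real.exp_neg, one_div]
      exact inv_anti₀ (by norm_num) (by have := Real.add_one_le_exp (1 : ℝ); linarith)
    have h3 : 1 ≤ Real.exp a * (1 / 2 : ℝ) ^ c := by
      calc (1 : ℝ) ≤ Real.exp (a + -(c : ℝ)) := Real.one_le_exp (by linarith)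
        _ = Real.exp a * Real.exp (-(c : ℝ)) := Real.exp_add _ _
        _ ≤ _ := mul_le_mul_of_nonneg_left h2 (Real.exp_pos _).le
    have := mul_le_mul_of_nonneg_left h3 (hw Z)
    linarith
  have b2 : (1 - (1 - 1 / 2) * (1 / 4) ^ k : ℝ) ^ (Finset.univ : Finset (Fin (4 * m))).card
      ≤ Real.exp (-(n * (1 / 4) ^ k / 2)) := by
    rw [Finset.card_univ, Fintype.card_fin]
    have hp : ((1 : ℝ) / 4) ^ k ≤ 1 := pow_le_one₀ (by norm_num) (by norm_num)
    calc _ ≤ (Real.exp (-((1 - 1 / 2) * (1 / 4) ^ k))) ^ (4 * m) := by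
          refine pow_le_pow_left₀ (by linarith) ?_ _
          exact Real.one_sub_le_exp_neg _
      _ = _ := by
          rw [← Real.exp_nat_mul]; congr 1; ring
  have hak : a ≤ n * (1 / 4) ^ k / 4 := by
    have e1 : ((1 : ℝ) / 8) ^ k = (1 / 4) ^ k * (1 / 2) ^ k := by rw [← mul_pow]; norm_num
    have e2 : ((1 : ℝ) / 2) ^ k ≤ 1 / 2 := pow_le_of_le_one (by norm_num) (by norm_num) hk.ne'
    have := mul_le_mul_of_nonneg_left e2 (show 0 ≤ n * (1 / 4) ^ k / 2 by positivity)
    rw [ha, e1]; linarith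
  rw [e]
  calc _ ≤ Real.exp a * Real.exp (-(n * (1 / 4) ^ k / 2)) :=
        b1.trans (mul_le_mul_of_nonneg_left (hit.trans b2) (Real.exp_pos _).le)
    _ = Real.exp (a + -(n * (1 / 4) ^ k / 2)) := (Real.exp_add _ _).symm
    _ ≤ Real.exp (-(n / 8) * (1 / 8) ^ k) := by
        apply Real.exp_le_exp.2
        have : -(n / 8) * (1 / 8) ^ k = - a / 4 := by rw [ha]; ring
        rw [this]; linarith
    _ < _ := by have := Real.exp_pos (-(n / 8) * (1 / 8) ^ k); linarith

/-- Core of Claim 3.3: `k` independent uniformly random `(3n/4)`-subsets of `[n]` (with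
`4 ∣ n` and `2k ≤ e^{n/8}`) leave at least `(n/2)·8^{−k}` elements of `[n]` uncovered,
except with probability less than `2·exp(−(n/8)·8^{−k})`. -/
theorem singleton_collection_coverage (n k : ℕ) (hn : 0 < n) (h4 : 4 ∣ n) (hk : 0 < k)
    (hke : (2 * k : ℝ) ≤ Real.exp ((n : ℝ) / 8)) :
    ((Measure.pi fun _ : Fin k => uniformSubsetMeasure n (3 * n / 4) (by omega))
        {Z : Fin k → Finset (Fin n) |
          (((Finset.univ : Finset (Fin n)) \ Finset.univ.sup Z).card : ℝ) <
            ((n : ℝ) / 2) * ((1 : ℝ) / 8) ^ k}).toReal <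
      2 * Real.exp (-((n : ℝ) / 8) * ((1 : ℝ) / 8) ^ k) := by
  obtain ⟨m, rfl⟩ := h4
  have hr : 3 * (4 * m) / 4 = 3 * m := by omega
  simp only [hr]
  exact main_aux m k hk (by omega)
end

section
/- Let n, t, k be positive integers with t dividing n, set s := n/t, and assume 2k ≤ e^{s/2}. Let U ⊆ [n] be a fixed nonempty subset, and let C_1, …, C_k be independent random subsets of [n], each distributed uniformly over all (n−s)-subsets of [n]. Then the probability that U ⊆ C_1 ∪ … ∪ C_k is at most 2·exp(−(|U|/8)·(1/(2t))^k). -/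
open MeasureTheory

theorem aux_choose (n r w : ℕ) (hr : r ≤ n) (hw : w ≤ r) :
    (n - w).choose (r - w) * n ^ w ≤ r ^ w * n.choose r := by
  induction w with
  | zero => simp
  | succ w ih =>
    have ih := ih (by omega)
    obtain ⟨a, ha⟩ : ∃ a, r = w + 1 + a := ⟨r - (w+1), by omega⟩
    obtain ⟨b, hb⟩ : ∃ b, n = w + 1 + b := ⟨n - (w+1), by omega⟩
    have e1 : n - (w+1) = b := by omega
    have e2 : r - (w+1) = a := by omega
    have e3 : n - w = b + 1 := by omega
    have e4 : r - w = a + 1 := by omega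
    rw [e1, e2]
    rw [e3, e4] at ih
    have h := Nat.add_one_mul_choose_eq b a
    have h2 : (a + 1) * n ≤ r * (b + 1) := by
      subst ha
      subst hb
      have : a ≤ b := by omega
      nlinarith
    refine Nat.le_of_mul_le_mul_left ?_ (Nat.succ_pos b)
    calc (b + 1) * (b.choose a * n ^ (w+1)) = ((b+1).choose (a+1) * n ^ w) * ((a + 1) * n) := by
          rw [← mul_assoc, h]; ring
      _ ≤ (r ^ w * n.choose r) * (r * (b + 1)) := Nat.mul_le_mul ih h2
      _ = (b + 1) * (r ^ (w+1) * n.choose r) := by ring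

theorem aux_card (n r : ℕ) (W : Finset (Fin n)) (hr : r ≤ n) :
    (Finset.univ.filter fun S : Finset (Fin n) => S.card = r ∧ W ⊆ S).card * n ^ W.card
      ≤ r ^ W.card * n.choose r := by
  by_cases hw : W.card ≤ r
  · refine le_trans (Nat.mul_le_mul_right _ ?_) (aux_choose n r W.card hr hw)
    have : (n - W.card).choose (r - W.card) = (Finset.powersetCard (r - W.card) Wᶜ).card := by
      rw [Finset.card_powersetCard, Finset.card_compl, Fintype.card_fin]
    rw [this]
    refine Finset.card_le_card_of_injOn (fun S => S \ W) ?_ ?_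
    · intro S hS
      simp only [Finset.coe_filter, Set.mem_ofPred_eq, Finset.mem_univ, true_and] at hS
      simp only [Finset.mem_coe, Finset.mem_powersetCard]
      refine ⟨?_, ?_⟩
      · intro x hx
        simp only [Finset.mem_sdiff] at hx
        simpa using hx.2
      · rw [Finset.card_sdiff_of_subset hS.2, hS.1]
    · intro S hS T hT h
      simp only [Finset.coe_filter, Set.mem_ofPred_eq, Finset.mem_univ, true_and] at hS hT
      rw [← Finset.sdiff_union_of_subset hS.2, ← Finset.sdiff_union_of_subset hT.2]
      simp only at h
      rw [h]
  · have : (Finset.univ.filter fun S : Finset (Fin n) => S.card = r ∧ W ⊆ S) = ∅ := by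
      ext S
      simp only [Finset.mem_filter, Finset.mem_univ, true_and, Finset.notMem_empty, iff_false]
      rintro ⟨h1, h2⟩
      exact hw (h1 ▸ Finset.card_le_card h2)
    simp [this]

/-- weight of a subset -/
noncomputable def auxW (n r : ℕ) (S : Finset (Fin n)) : ℝ :=
  if S.card = r then ((n.choose r : ℝ))⁻¹ else 0

theorem auxW_nonneg (n r : ℕ) (S : Finset (Fin n)) : 0 ≤ auxW n r S := by
  unfold auxW; split_ifs <;> positivity

theorem aux_superset (n r : ℕ) (hn : 0 < n) (W : Finset (Fin n)) (hr : r ≤ n) :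
    ∑ S : Finset (Fin n), (if W ⊆ S then auxW n r S else 0) ≤ ((r : ℝ) / n) ^ W.card := by
  have h := aux_card n r W hr
  have h' : ((Finset.univ.filter fun S : Finset (Fin n) => S.card = r ∧ W ⊆ S).card : ℝ)
      * (n:ℝ) ^ W.card ≤ (r:ℝ) ^ W.card * n.choose r := by exact_mod_cast h
  have hc : (0:ℝ) < n.choose r := by exact_mod_cast Nat.choose_pos hr
  have hn' : (0:ℝ) < n := by exact_mod_cast hn
  have e : ∑ S : Finset (Fin n), (if W ⊆ S then auxW n r S else 0)
      = ((Finset.univ.filter fun S : Finset (Fin n) => S.card = r ∧ W ⊆ S).card : ℝ)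
        * ((n.choose r : ℝ))⁻¹ := by
    rw [← nsmul_eq_mul, ← Finset.sum_const, Finset.sum_filter]
    refine Finset.sum_congr rfl fun S _ => ?_
    unfold auxW
    by_cases h1 : S.card = r <;> by_cases h2 : W ⊆ S <;> simp [h1, h2]
  rw [e, div_pow, ← div_eq_mul_inv, div_le_div_iff₀ hc (by positivity)]
  exact h'

theorem aux_ident {n : ℕ} (U S : Finset (Fin n)) (x : ℝ) :
    x ^ (U \ S).card = ∑ W ∈ U.powerset,
      (if W ⊆ S then (1 - x) ^ W.card * x ^ (U.card - W.card) else 0) := by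
  rw [← Finset.sum_filter]
  have : U.powerset.filter (fun W => W ⊆ S) = (U ∩ S).powerset := by
    ext W
    simp only [Finset.mem_filter, Finset.mem_powerset, Finset.subset_inter_iff]
  rw [this]
  have hc : U.card = (U ∩ S).card + (U \ S).card := (Finset.card_inter_add_card_sdiff U S).symm
  have h2 : ∀ W ∈ (U ∩ S).powerset, (1 - x) ^ W.card * x ^ (U.card - W.card)
      = ((1 - x) ^ W.card * x ^ ((U ∩ S).card - W.card)) * x ^ (U \ S).card := by
    intro W hW
    have := Finset.card_le_card (Finset.mem_powerset.1 hW)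
    rw [mul_assoc, ← pow_add]
    congr 2
    omega
  rw [Finset.sum_congr rfl h2, ← Finset.sum_mul, Finset.sum_pow_mul_eq_add_pow]
  simp

theorem aux_mgf (n r : ℕ) (hn : 0 < n) (hr : r ≤ n) (U : Finset (Fin n)) (x : ℝ)
    (hx0 : 0 ≤ x) (hx1 : x ≤ 1) :
    ∑ S : Finset (Fin n), auxW n r S * x ^ (U \ S).card
      ≤ ((1 - x) * ((r : ℝ) / n) + x) ^ U.card := by
  have h1x : 0 ≤ 1 - x := by linarith
  calc ∑ S : Finset (Fin n), auxW n r S * x ^ (U \ S).card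
      = ∑ S : Finset (Fin n), ∑ W ∈ U.powerset, ((1 - x) ^ W.card * x ^ (U.card - W.card)) *
          (if W ⊆ S then auxW n r S else 0) := by
        refine Finset.sum_congr rfl fun S _ => ?_
        rw [aux_ident, Finset.mul_sum]
        refine Finset.sum_congr rfl fun W _ => ?_
        split_ifs
        · ring
        · simp
    _ = ∑ W ∈ U.powerset, ((1 - x) ^ W.card * x ^ (U.card - W.card)) *
          ∑ S : Finset (Fin n), (if W ⊆ S then auxW n r S else 0) := by
        rw [Finset.sum_comm]
        simp only [Finset.mul_sum]
    _ ≤ ∑ W ∈ U.powerset, ((1 - x) ^ W.card * x ^ (U.card - W.card)) * ((r : ℝ) / n) ^ W.card := by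
        refine Finset.sum_le_sum fun W _ => ?_
        exact mul_le_mul_of_nonneg_left (aux_superset n r hn W hr) (by positivity)
    _ = ∑ W ∈ U.powerset, (((1 - x) * ((r : ℝ) / n)) ^ W.card * x ^ (U.card - W.card)) := by
        refine Finset.sum_congr rfl fun W _ => ?_
        rw [mul_pow]; ring
    _ = _ := by rw [Finset.sum_pow_mul_eq_add_pow]

theorem aux_main (n r : ℕ) (hn : 0 < n) (hr : r ≤ n) (k : ℕ) (U : Finset (Fin n)) :
    ∑ C : Fin k → Finset (Fin n),
      (if U ⊆ Finset.univ.sup C then ∏ i, auxW n r (C i) else 0)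
      ≤ (1 - (1 - (r : ℝ) / n) ^ k) ^ U.card := by
  have hn' : (0:ℝ) < n := by exact_mod_cast hn
  have hq1 : (r : ℝ) / n ≤ 1 := by
    rw [div_le_one hn']; exact_mod_cast hr
  have hq0 : 0 ≤ (r : ℝ) / n := by positivity
  induction k generalizing U with
  | zero =>
    by_cases h : U = ∅
    · simp [h]
    · simp [h]
  | succ k ih =>
    rw [← (Fin.consEquiv fun _ => Finset (Fin n)).sum_comp, Fintype.sum_prod_type]
    have hstep : ∀ S : Finset (Fin n), ∀ C : Fin k → Finset (Fin n),
        (if U ⊆ Finset.univ.sup ((Fin.consEquiv fun _ => Finset (Fin n)) (S, C)) then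
          ∏ i, auxW n r ((Fin.consEquiv fun _ => Finset (Fin n)) (S, C) i) else 0)
        = auxW n r S * (if U \ S ⊆ Finset.univ.sup C then ∏ i, auxW n r (C i) else 0) := by
      intro S C
      have e : (U ⊆ Finset.univ.sup ((Fin.consEquiv fun _ => Finset (Fin n)) (S, C)))
          ↔ U \ S ⊆ Finset.univ.sup C := by
        simp only [Fin.consEquiv_apply, Finset.subset_iff, Finset.mem_sup, Finset.mem_univ,
          true_and, Fin.exists_fin_succ, Fin.cons_zero, Fin.cons_succ, Finset.mem_sdiff]
        grind
      simp only [e, Fin.prod_univ_succ, Fin.consEquiv_apply, Fin.cons_zero, Fin.cons_succ, mul_ite,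
        mul_zero]
    simp only [hstep, ← Finset.mul_sum]
    have hp0 : 0 ≤ (1 - (r : ℝ) / n) ^ k := pow_nonneg (by linarith) _
    have hp1 : (1 - (r : ℝ) / n) ^ k ≤ 1 := pow_le_one₀ (by linarith) (by linarith)
    refine (Finset.sum_le_sum fun S _ =>
      mul_le_mul_of_nonneg_left (ih (U \ S)) (auxW_nonneg n r S)).trans ?_
    refine (aux_mgf n r hn hr U _ (by linarith) (by linarith)).trans (le_of_eq ?_)
    congr 1
    ring

instance auxMSC (n : ℕ) : MeasurableSingletonClass (Finset (Fin n)) := ⟨fun _ => trivial⟩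

instance auxProb (n r : ℕ) (h : r ≤ n) : IsProbabilityMeasure (uniformSubsetMeasure n r h) := by
  unfold uniformSubsetMeasure; infer_instance

theorem aux_singleton (n r : ℕ) (h : r ≤ n) (S : Finset (Fin n)) :
    (uniformSubsetMeasure n r h).real {S} = auxW n r S := by
  unfold uniformSubsetMeasure auxW Measure.real
  rw [PMF.toMeasure_apply_singleton _ _ (measurableSet_singleton _), PMF.uniformOfFinset_apply]
  have : (Finset.univ.filter fun S : Finset (Fin n) => S.card = r).card = n.choose r := by
    rw [← Finset.powerset_univ, ← Finset.powersetCard_eq_filter, Finset.card_powersetCard]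
    simp
  simp only [Finset.mem_filter, Finset.mem_univ, true_and, this]
  split_ifs <;> simp

theorem aux_measure (n r k : ℕ) (h : r ≤ n) (U : Finset (Fin n)) :
    ((Measure.pi fun _ : Fin k => uniformSubsetMeasure n r h)
        {C : Fin k → Finset (Fin n) | U ⊆ Finset.univ.sup C}).toReal
    = ∑ C : Fin k → Finset (Fin n),
      (if U ⊆ Finset.univ.sup C then ∏ i, auxW n r (C i) else 0) := by
  classical
  rw [← Finset.sum_filter]
  have e : {C : Fin k → Finset (Fin n) | U ⊆ Finset.univ.sup C}
    = ((Finset.univ.filter fun C : Fin k → Finset (Fin n) => U ⊆ Finset.univ.sup C :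
        Finset (Fin k → Finset (Fin n))) : Set _) := by
    ext; simp
  rw [e]
  change Measure.real _ _ = _
  rw [← sum_measureReal_singleton]
  refine Finset.sum_congr rfl fun C _ => ?_
  rw [Measure.real, Measure.pi_singleton, ENNReal.toReal_prod]
  exact Finset.prod_congr rfl fun i _ => aux_singleton n r h (C i)

/-- Pair-collection bound from the proof of Lemma 3.2: with `s = n/t` (where `t ∣ n`) and
`2k ≤ e^{s/2}`, `k` independent uniformly random `(n−s)`-subsets of `[n]` cover a fixed
nonempty set `U ⊆ [n]` with probability at most `2·exp(−(|U|/8)·(1/(2t))^k)`. -/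
theorem pair_collection_coverage (n t k : ℕ) (hn : 0 < n) (ht : 0 < t) (hk : 0 < k)
    (htn : t ∣ n)
    (hke : (2 * k : ℝ) ≤ Real.exp ((n / t : ℕ) / 2 : ℝ))
    (U : Finset (Fin n)) (hU : U.Nonempty) :
    ((Measure.pi fun _ : Fin k => uniformSubsetMeasure n (n - n / t) (Nat.sub_le n (n / t)))
        {C : Fin k → Finset (Fin n) | U ⊆ Finset.univ.sup C}).toReal ≤
      2 * Real.exp (-((U.card : ℝ) / 8) * ((1 : ℝ) / (2 * t)) ^ k) := by
  rw [aux_measure]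
  refine (aux_main n (n - n / t) hn (Nat.sub_le _ _) k U).trans ?_
  have hn' : (0:ℝ) < n := by exact_mod_cast hn
  have ht' : (1:ℝ) ≤ t := by exact_mod_cast ht
  have hq : 1 - ((n - n / t : ℕ) : ℝ) / n = 1 / t := by
    rw [Nat.cast_sub (Nat.div_le_self _ _), Nat.cast_div htn (by positivity)]
    field_simp
    ring
  rw [hq]
  have hp0 : (0:ℝ) ≤ (1 / (t:ℝ)) ^ k := by positivity
  have hp1 : (1 / (t:ℝ)) ^ k ≤ 1 :=
    pow_le_one₀ (by positivity) (by rw [div_le_one (by linarith)]; exact ht')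
  have hle : ((1 : ℝ) / (2 * t)) ^ k ≤ (1 / (t:ℝ)) ^ k := by
    gcongr
    linarith
  have h0 : (0:ℝ) ≤ ((1 : ℝ) / (2 * t)) ^ k := by positivity
  have hu : (0:ℝ) ≤ U.card := by positivity
  calc (1 - (1 / (t:ℝ)) ^ k) ^ U.card ≤ (Real.exp (-(1 / (t:ℝ)) ^ k)) ^ U.card := by
        refine pow_le_pow_left₀ (by linarith) ?_ _
        have := Real.add_one_le_exp (-(1 / (t:ℝ)) ^ k)
        linarith
    _ = Real.exp (U.card * (-(1 / (t:ℝ)) ^ k)) := by rw [← Real.exp_nat_mul]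
    _ ≤ Real.exp (-((U.card : ℝ) / 8) * ((1 : ℝ) / (2 * t)) ^ k) := by
        apply Real.exp_le_exp.2
        have := mul_le_mul_of_nonneg_left hle hu
        have := mul_nonneg hu h0
        linarith
    _ ≤ _ := by
        have := Real.exp_pos (-((U.card : ℝ) / 8) * ((1 : ℝ) / (2 * t)) ^ k)
        linarith
end
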